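/- Let Ω ⊂ ℝⁿ be compact and convex, p ∈ (0,1], α, β > 0, let Y be a Hilbert space, let K : M(Ω) → Y be a linear operator that is continuous from the weak* topology of M(Ω) to the norm topology of Y, and let F : Y → ℝ be convex, bounded from below, and Fréchet differentiable. Then the problem inf_{μ ∈ M(Ω)} [ F(Kμ) + ‖μ‖_{KR_p^{α,β}} ] admits at least one minimizer μ̄ ∈ M(Ω). -/

import Mathlib

open MeasureTheory ENNReal

noncomputable section

variable {X : Type*} [MeasurableSpace X]

/-- Couplings (transport plans) between two nonnegative measures. -/
def couplings (ρ₁ ρ₂ : Measure X) : Set (Measure (X × X)) :=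
  {γ | γ.map Prod.fst = ρ₁ ∧ γ.map Prod.snd = ρ₂}

/-- The transport cost of a plan for the cost `|x-y|^p`. -/
def transportCost [PseudoMetricSpace X] (p : ℝ) (γ : Measure (X × X)) : ℝ≥0∞ :=
  ∫⁻ z, ENNReal.ofReal (dist z.1 z.2 ^ p) ∂γ

/-- The `p`-Wasserstein cost `W_p` (no `1/p`-th power is taken); it is `∞` if
there is no coupling. -/
def W [PseudoMetricSpace X] (p : ℝ) (ρ₁ ρ₂ : Measure X) : ℝ≥0∞ :=
  ⨅ (γ : Measure (X × X)) (_ : γ ∈ couplings ρ₁ ρ₂), transportCost p γ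

/-- Positive part `μ⁺` of the Hahn-Jordan decomposition. -/
def pos (μ : SignedMeasure X) : Measure X := μ.toJordanDecomposition.posPart

/-- Negative part `μ⁻` of the Hahn-Jordan decomposition. -/
def neg (μ : SignedMeasure X) : Measure X := μ.toJordanDecomposition.negPart

/-- Total variation `|μ|(Ω)`. -/
def tv (μ : SignedMeasure X) : ℝ≥0∞ := μ.totalVariation Set.univ

/-- The generalized Kantorovich-Rubinstein norm `‖μ‖_{KR_p^{α,β}}`. -/
def KRnorm [PseudoMetricSpace X] (p α β : ℝ) (μ : SignedMeasure X) : ℝ≥0∞ :=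
  ⨅ (ν : SignedMeasure X) (_ : ν Set.univ = 0),
    W p (pos ν) (neg ν) + ENNReal.ofReal (β / 2) * tv ν + ENNReal.ofReal α * tv (μ - ν)

/-- Dirac delta `δ_x` as a signed measure. -/
def sDirac (x : X) : SignedMeasure X := (Measure.dirac x).toSignedMeasure

/-- Duality pairing `∫ q dμ` of a continuous function against a signed measure. -/
def pairing [TopologicalSpace X] (q : C(X, ℝ)) (μ : SignedMeasure X) : ℝ :=
  ∫ x, q x ∂(pos μ) - ∫ x, q x ∂(neg μ)

/-- The weak* topology on signed measures, induced by testing against `C₀` functions. -/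
def weakStar (X : Type*) [MeasurableSpace X] [TopologicalSpace X] :
    TopologicalSpace (SignedMeasure X) :=
  TopologicalSpace.induced
    (fun μ => fun f : ZeroAtInftyContinuousMap X ℝ =>
      ∫ x, f x ∂(pos μ) - ∫ x, f x ∂(neg μ))
    Pi.topologicalSpace

/-- Support of a nonnegative measure. -/
def msupport [TopologicalSpace X] (μ : Measure X) : Set X :=
  {x | ∀ U : Set X, IsOpen U → x ∈ U → μ U ≠ 0}

end

open ProbabilityTheory Set

section SignedMeasure

variable {X : Type*} [MeasurableSpace X]

instance isFiniteMeasure_pos (μ : SignedMeasure X) : IsFiniteMeasure (pos μ) :=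
  inferInstanceAs (IsFiniteMeasure μ.toJordanDecomposition.posPart)

instance isFiniteMeasure_neg (μ : SignedMeasure X) : IsFiniteMeasure (neg μ) :=
  inferInstanceAs (IsFiniteMeasure μ.toJordanDecomposition.negPart)

theorem toSignedMeasure_pos_sub_neg (μ : SignedMeasure X) :
    (pos μ).toSignedMeasure - (neg μ).toSignedMeasure = μ :=
  μ.toSignedMeasure_toJordanDecomposition

theorem pos_sub_add_eq_add_neg_sub (μ ν : Measure X) [IsFiniteMeasure μ] [IsFiniteMeasure ν] :
    pos (μ.toSignedMeasure - ν.toSignedMeasure) + ν =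
      μ + neg (μ.toSignedMeasure - ν.toSignedMeasure) := by
  rw [← Measure.toSignedMeasure_eq_toSignedMeasure_iff, Measure.toSignedMeasure_add,
    Measure.toSignedMeasure_add, ← sub_eq_sub_iff_add_eq_add]
  exact toSignedMeasure_pos_sub_neg _

theorem pos_neg_sub_of_mutuallySingular {μ ν : Measure X} [IsFiniteMeasure μ]
    [IsFiniteMeasure ν] (h : μ ⟂ₘ ν) :
    pos (μ.toSignedMeasure - ν.toSignedMeasure) = μ ∧
      neg (μ.toSignedMeasure - ν.toSignedMeasure) = ν := by
  have key : (μ.toSignedMeasure - ν.toSignedMeasure).toJordanDecomposition =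
      { posPart := μ, negPart := ν, mutuallySingular := h } :=
    SignedMeasure.toJordanDecomposition_eq rfl
  exact ⟨by rw [pos, key], by rw [neg, key]⟩

theorem tv_eq (μ : SignedMeasure X) : tv μ = pos μ univ + neg μ univ := rfl

theorem tv_sub_le (μ ν : Measure X) [IsFiniteMeasure μ] [IsFiniteMeasure ν] :
    tv (μ.toSignedMeasure - ν.toSignedMeasure) ≤ μ univ + ν univ := by
  have hadd := pos_sub_add_eq_add_neg_sub μ ν
  obtain ⟨S, hS, hpos, hneg⟩ :=
    (μ.toSignedMeasure - ν.toSignedMeasure).toJordanDecomposition.mutuallySingular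
  change pos _ S = 0 at hpos
  change neg _ Sᶜ = 0 at hneg
  rw [tv_eq]
  set P := pos (μ.toSignedMeasure - ν.toSignedMeasure)
  set N := neg (μ.toSignedMeasure - ν.toSignedMeasure)
  have hP : P univ ≤ μ univ := by
    rw [← measure_add_measure_compl hS, hpos, zero_add]
    calc P Sᶜ ≤ (P + ν) Sᶜ := by simp
      _ = μ Sᶜ := by rw [hadd]; simp [hneg]
      _ ≤ μ univ := measure_mono (subset_univ _)
  have hN : N univ ≤ ν univ := by
    rw [← measure_add_measure_compl hS, hneg, add_zero]
    calc N S ≤ (μ + N) S := by simp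
      _ = ν S := by rw [← hadd]; simp [hpos]
      _ ≤ ν univ := measure_mono (subset_univ _)
  exact add_le_add hP hN

theorem integral_pos_sub_integral_neg (μ ν : Measure X) [IsFiniteMeasure μ] [IsFiniteMeasure ν]
    {f : X → ℝ} (hf : ∀ ρ : Measure X, IsFiniteMeasure ρ → Integrable f ρ) :
    ∫ x, f x ∂(pos (μ.toSignedMeasure - ν.toSignedMeasure)) -
      ∫ x, f x ∂(neg (μ.toSignedMeasure - ν.toSignedMeasure)) =
      ∫ x, f x ∂μ - ∫ x, f x ∂ν := by
  rw [sub_eq_sub_iff_add_eq_add, ← integral_add_measure (hf _ inferInstance) (hf _ inferInstance),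
    ← integral_add_measure (hf _ inferInstance) (hf _ inferInstance), pos_sub_add_eq_add_neg_sub]

theorem continuous_weakStar_toSignedMeasure_sub [TopologicalSpace X] [OpensMeasurableSpace X]
    [CompactSpace X] :
    @Continuous (FiniteMeasure X × FiniteMeasure X) (SignedMeasure X) _ (weakStar X)
      fun m => (m.1 : Measure X).toSignedMeasure - (m.2 : Measure X).toSignedMeasure := by
  refine continuous_induced_rng.2 (continuous_pi fun f => ?_)
  have hf : ∀ ρ : Measure X, IsFiniteMeasure ρ → Integrable f ρ := fun ρ _ =>
    BoundedContinuousFunction.integrable ρ f.toBCF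
  simp only [Function.comp_def, integral_pos_sub_integral_neg _ _ hf]
  exact ((FiniteMeasure.continuous_integral_continuousMap f).comp continuous_fst).sub
    ((FiniteMeasure.continuous_integral_continuousMap f).comp continuous_snd)

end SignedMeasure

section Transport

variable {X : Type*} [MeasurableSpace X]

theorem compProd_mono_left {Y : Type*} [MeasurableSpace Y] {μ ν : Measure X} [IsFiniteMeasure μ]
    [SFinite ν] (h : μ ≤ ν) (κ : Kernel X Y) : μ ⊗ₘ κ ≤ ν ⊗ₘ κ := by
  by_cases hκ : IsSFiniteKernel κ
  · refine Measure.le_iff.2 fun s hs => ?_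
    rw [Measure.compProd_apply hs, Measure.compProd_apply hs]
    exact lintegral_mono' h le_rfl
  · simp [Measure.compProd_of_not_isSFiniteKernel _ _ hκ]

/-- Gluing of the part of a plan that arrives in `τ` with the part that leaves from `τ`. -/
theorem exists_gluing_le [StandardBorelSpace X] (γ : Measure (X × X)) [IsFiniteMeasure γ]
    (τ : Measure X) (h₁ : τ ≤ γ.map Prod.fst) (h₂ : τ ≤ γ.map Prod.snd) :
    ∃ T : Measure (X × X × X), T.map Prod.fst = τ ∧
      T.map (fun t => (t.1, t.2.2)) ≤ γ ∧ T.map (fun t => (t.2.1, t.1)) ≤ γ := by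
  have : IsFiniteMeasure τ := isFiniteMeasure_of_le _ h₁
  cases isEmpty_or_nonempty X
  · exact ⟨0, Subsingleton.elim _ _, by simp, by simp⟩
  set k₁ : Kernel X X := γ.condKernel
  set γ' := γ.map Prod.swap
  set k₂ : Kernel X X := γ'.condKernel
  have hγ' : γ'.fst = γ.map Prod.snd := by
    rw [Measure.fst, Measure.map_map measurable_fst measurable_swap]; rfl
  refine ⟨τ ⊗ₘ (k₂ ×ₖ k₁), Measure.fst_compProd _ _, ?_, ?_⟩
  · have : (τ ⊗ₘ (k₂ ×ₖ k₁)).map (fun t => (t.1, t.2.2)) = τ ⊗ₘ k₁ := by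
      conv_rhs => rw [← Kernel.snd_prod k₂ k₁, Kernel.snd_eq, Measure.compProd_map measurable_snd]
      rfl
    rw [this]
    exact (compProd_mono_left h₁ k₁).trans_eq (γ.disintegrate k₁)
  · have : (τ ⊗ₘ (k₂ ×ₖ k₁)).map (fun t => (t.2.1, t.1)) = (τ ⊗ₘ k₂).map Prod.swap := by
      conv_rhs => rw [← Kernel.fst_prod k₂ k₁, Kernel.fst_eq, Measure.compProd_map measurable_fst]
      rw [Measure.map_map measurable_swap (by fun_prop)]; rfl
    rw [this]
    calc (τ ⊗ₘ k₂).map Prod.swap ≤ (γ'.fst ⊗ₘ k₂).map Prod.swap :=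
          Measure.map_mono (compProd_mono_left (hγ' ▸ h₂) k₂) measurable_swap
      _ = γ := by
        rw [γ'.disintegrate k₂, Measure.map_map measurable_swap measurable_swap]
        simp

theorem exists_shortcut_plan [StandardBorelSpace X] (γ : Measure (X × X)) [IsFiniteMeasure γ]
    {c : X × X → ℝ≥0∞} (hc : Measurable c) (htri : ∀ x y z, c (x, z) ≤ c (x, y) + c (y, z))
    (hsing : ¬ γ.map Prod.fst ⟂ₘ γ.map Prod.snd) :
    ∃ (γ' : Measure (X × X)) (τ : Measure X), τ ≠ 0 ∧ γ'.map Prod.fst + τ = γ.map Prod.fst ∧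
      γ'.map Prod.snd + τ = γ.map Prod.snd ∧ ∫⁻ z, c z ∂γ' ≤ ∫⁻ z, c z ∂γ := by
  obtain ⟨τ, h₁, h₂, h0⟩ : ∃ τ, τ ≤ γ.map Prod.fst ∧ τ ≤ γ.map Prod.snd ∧ τ ≠ 0 := by
    rw [Measure.mutuallySingular_iff_disjoint, Disjoint] at hsing
    push Not at hsing
    obtain ⟨τ, h₁, h₂, h⟩ := hsing
    exact ⟨τ, h₁, h₂, fun h0 => h (h0.trans_le (Measure.zero_le _))⟩
  obtain ⟨T, hτ, hT₁, hT₂⟩ := exists_gluing_le γ τ h₁ h₂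
  set η₁ := T.map (fun t => (t.1, t.2.2))
  set η₂ := T.map (fun t => (t.2.1, t.1))
  set θ := T.map (fun t => (t.2.1, t.2.2))
  have : IsFiniteMeasure η₁ := isFiniteMeasure_of_le _ hT₁
  have : IsFiniteMeasure η₂ := isFiniteMeasure_of_le _ hT₂
  set a : ℝ≥0∞ := 2⁻¹
  have hle : a • (η₁ + η₂) ≤ γ := by
    calc a • (η₁ + η₂) ≤ a • (γ + γ) := by gcongr
      _ = γ := by rw [← two_smul ℝ≥0∞ γ, smul_smul, ENNReal.inv_mul_cancel] <;> simp
  have : IsFiniteMeasure (a • (η₁ + η₂)) := isFiniteMeasure_of_le _ hle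
  set R := γ - a • (η₁ + η₂)
  have hR : R + a • (η₁ + η₂) = γ := Measure.sub_add_cancel_of_le hle
  refine ⟨R + a • θ, a • τ, by simpa [a] using h0, ?_, ?_, ?_⟩
  · have e₁ : η₁.map Prod.fst = τ := by
      rw [← hτ, Measure.map_map measurable_fst (by fun_prop)]; rfl
    have e₂ : η₂.map Prod.fst = θ.map Prod.fst := by
      rw [Measure.map_map measurable_fst (by fun_prop), Measure.map_map measurable_fst (by fun_prop)]
      rfl
    conv_rhs => rw [← hR]
    simp only [Measure.map_add _ _ measurable_fst, Measure.map_smul, smul_add, e₁, e₂]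
    abel
  · have e₁ : η₁.map Prod.snd = θ.map Prod.snd := by
      rw [Measure.map_map measurable_snd (by fun_prop), Measure.map_map measurable_snd (by fun_prop)]
      rfl
    have e₂ : η₂.map Prod.snd = τ := by
      rw [← hτ, Measure.map_map measurable_snd (by fun_prop)]; rfl
    conv_rhs => rw [← hR]
    simp only [Measure.map_add _ _ measurable_snd, Measure.map_smul, smul_add, e₁, e₂]
    abel
  · have hθ : ∫⁻ z, c z ∂θ ≤ ∫⁻ z, c z ∂(η₁ + η₂) := by
      rw [lintegral_add_measure, lintegral_map hc (by fun_prop), lintegral_map hc (by fun_prop),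
        lintegral_map hc (by fun_prop), ← lintegral_add_left (by fun_prop)]
      exact lintegral_mono fun t => (htri _ t.1 _).trans_eq (add_comm _ _)
    conv_rhs => rw [← hR]
    rw [lintegral_add_measure, lintegral_add_measure, lintegral_smul_measure,
      lintegral_smul_measure]
    gcongr

end Transport

section Relaxation

variable {X : Type*} [MeasurableSpace X]

/-- The signed measure generated by a plan together with a pair of nonnegative measures. -/
noncomputable def netMeasure (t : FiniteMeasure (X × X) × FiniteMeasure X × FiniteMeasure X) :
    SignedMeasure X :=
  (t.1.map Prod.fst + t.2.1 : FiniteMeasure X).toMeasure.toSignedMeasure -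
    (t.1.map Prod.snd + t.2.2 : FiniteMeasure X).toMeasure.toSignedMeasure

/-- The cost of a plan together with a pair of nonnegative measures. -/
noncomputable def relaxedCost [PseudoMetricSpace X] (p α β : ℝ)
    (t : FiniteMeasure (X × X) × FiniteMeasure X × FiniteMeasure X) : ℝ≥0∞ :=
  transportCost p (t.1 : Measure (X × X)) + ENNReal.ofReal β * t.1.mass +
    ENNReal.ofReal α * (t.2.1.mass + t.2.2.mass)

theorem netMeasure_eq (t : FiniteMeasure (X × X) × FiniteMeasure X × FiniteMeasure X) :
    netMeasure t =
      ((t.1.map Prod.fst).toMeasure.toSignedMeasure -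
        (t.1.map Prod.snd).toMeasure.toSignedMeasure) +
      ((t.2.1 : Measure X).toSignedMeasure - (t.2.2 : Measure X).toSignedMeasure) := by
  simp only [netMeasure, FiniteMeasure.toMeasure_add, Measure.toSignedMeasure_add]
  abel

theorem mass_eq_map_fst (γ : FiniteMeasure (X × X)) : γ.mass = (γ.map Prod.fst).mass := by
  simp [FiniteMeasure.mass, FiniteMeasure.map_apply _ measurable_fst MeasurableSet.univ]

theorem mass_eq_map_snd (γ : FiniteMeasure (X × X)) : γ.mass = (γ.map Prod.snd).mass := by
  simp [FiniteMeasure.mass, FiniteMeasure.map_apply _ measurable_snd MeasurableSet.univ]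

section PseudoMetric

variable [PseudoMetricSpace X] {p α β : ℝ}

theorem le_KRnorm {r : ℝ≥0∞} {μ : SignedMeasure X} (hβ : 0 ≤ β)
    (h : ∀ t, netMeasure t = μ → r ≤ relaxedCost p α β t) : r ≤ KRnorm p α β μ := by
  refine le_iInf₂ fun ν _ => ?_
  rw [add_assoc, W, ENNReal.iInf_add]
  refine le_iInf fun γ => ?_
  rw [ENNReal.iInf_add]
  refine le_iInf fun hγ => ?_
  have hfin : IsFiniteMeasure γ := by
    have : IsFiniteMeasure (γ.map Prod.fst) := hγ.1 ▸ inferInstance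
    exact Measure.isFiniteMeasure_of_map measurable_fst.aemeasurable
  let g : FiniteMeasure (X × X) := ⟨γ, hfin⟩
  let σ₁ : FiniteMeasure X := ⟨pos (μ - ν), inferInstance⟩
  let σ₂ : FiniteMeasure X := ⟨neg (μ - ν), inferInstance⟩
  have hfst : (g.map Prod.fst).toMeasure = pos ν := hγ.1
  have hsnd : (g.map Prod.snd).toMeasure = neg ν := hγ.2
  refine (h (g, σ₁, σ₂) ?_).trans_eq ?_
  · simp only [netMeasure_eq, hfst, hsnd, toSignedMeasure_pos_sub_neg]
    change ν + ((pos (μ - ν)).toSignedMeasure - (neg (μ - ν)).toSignedMeasure) = μ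
    rw [toSignedMeasure_pos_sub_neg, add_sub_cancel]
  · have h₁ : pos ν univ = g.mass := by
      rw [mass_eq_map_fst, FiniteMeasure.ennreal_mass, hfst]
    have h₂ : neg ν univ = g.mass := by
      rw [mass_eq_map_snd, FiniteMeasure.ennreal_mass, hsnd]
    have hb : ENNReal.ofReal (β / 2) * tv ν = ENNReal.ofReal β * g.mass := by
      rw [tv_eq, h₁, h₂, ← two_mul, ← mul_assoc, ← ENNReal.ofReal_ofNat,
        ← ENNReal.ofReal_mul (by positivity), div_mul_cancel₀ _ two_ne_zero]
    rw [hb, relaxedCost, add_assoc, FiniteMeasure.ennreal_mass (μ := σ₁),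
      FiniteMeasure.ennreal_mass (μ := σ₂)]
    rfl

theorem KRnorm_netMeasure_le (hβ : 0 ≤ β)
    (t : FiniteMeasure (X × X) × FiniteMeasure X × FiniteMeasure X)
    (hsing : (t.1.map Prod.fst).toMeasure ⟂ₘ (t.1.map Prod.snd).toMeasure) :
    KRnorm p α β (netMeasure t) ≤ relaxedCost p α β t := by
  set ν := (t.1.map Prod.fst).toMeasure.toSignedMeasure -
    (t.1.map Prod.snd).toMeasure.toSignedMeasure with hν
  obtain ⟨hpos, hneg⟩ := pos_neg_sub_of_mutuallySingular hsing
  rw [← hν] at hpos hneg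
  have h₁ : pos ν univ = t.1.mass := by rw [hpos, mass_eq_map_fst, FiniteMeasure.ennreal_mass]
  have h₂ : neg ν univ = t.1.mass := by rw [hneg, mass_eq_map_snd, FiniteMeasure.ennreal_mass]
  have h0 : ν univ = 0 := by
    rw [SignedMeasure.apply_eq_posPart_real_sub_negPart_real _ MeasurableSet.univ]
    change (pos ν univ).toReal - (neg ν univ).toReal = 0
    rw [h₁, h₂, sub_self]
  refine (iInf₂_le ν h0).trans ?_
  have hb : ENNReal.ofReal (β / 2) * tv ν = ENNReal.ofReal β * t.1.mass := by
    rw [tv_eq, h₁, h₂, ← two_mul, ← mul_assoc, ← ENNReal.ofReal_ofNat,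
      ← ENNReal.ofReal_mul (by positivity), div_mul_cancel₀ _ two_ne_zero]
  rw [hb, relaxedCost, netMeasure_eq, ← hν, add_sub_cancel_left]
  gcongr
  · exact iInf₂_le _ ⟨hpos.symm, hneg.symm⟩
  · simpa only [FiniteMeasure.ennreal_mass] using tv_sub_le _ _

theorem KRnorm_lt_top (μ : SignedMeasure X) : KRnorm p α β μ < ⊤ := by
  refine (iInf₂_le 0 (by simp)).trans_lt ?_
  have hW : W p (pos (0 : SignedMeasure X)) (neg 0) ≤ 0 :=
    (iInf₂_le 0 (by simp [couplings, pos, neg, SignedMeasure.toJordanDecomposition_zero])).trans_eq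
      (by simp [transportCost])
  have h0 : tv (0 : SignedMeasure X) = 0 := by simp [tv, SignedMeasure.totalVariation_zero]
  rw [nonpos_iff_eq_zero.1 hW, h0]
  simp only [mul_zero, add_zero, zero_add, sub_zero]
  exact ENNReal.mul_lt_top ENNReal.ofReal_lt_top (measure_lt_top _ _)

end PseudoMetric

variable [MetricSpace X] [CompactSpace X] [BorelSpace X] {p α β : ℝ}

theorem transportCost_eq_ofReal_integral (hp : 0 < p) (γ : FiniteMeasure (X × X)) :
    transportCost p (γ : Measure (X × X)) =
      ENNReal.ofReal (∫ z, dist z.1 z.2 ^ p ∂(γ : Measure (X × X))) := by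
  have hcont : Continuous fun z : X × X => dist z.1 z.2 ^ p :=
    continuous_dist.rpow_const fun _ => Or.inr hp.le
  refine (ofReal_integral_eq_lintegral_ofReal ?_ ?_).symm
  · exact BoundedContinuousFunction.integrable _
      (BoundedContinuousFunction.mkOfCompact ⟨_, hcont⟩)
  · exact .of_forall fun z => by positivity

theorem relaxedCost_lt_top (hp : 0 < p)
    (t : FiniteMeasure (X × X) × FiniteMeasure X × FiniteMeasure X) :
    relaxedCost p α β t < ⊤ := by
  rw [relaxedCost, transportCost_eq_ofReal_integral hp]
  exact ENNReal.add_lt_top.2 ⟨ENNReal.add_lt_top.2 ⟨ENNReal.ofReal_lt_top,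
    ENNReal.mul_lt_top ENNReal.ofReal_lt_top ENNReal.coe_lt_top⟩,
    ENNReal.mul_lt_top ENNReal.ofReal_lt_top (by simp)⟩

theorem continuous_toReal_relaxedCost (hp : 0 < p) (hα : 0 ≤ α) (hβ : 0 ≤ β) :
    Continuous fun t : FiniteMeasure (X × X) × FiniteMeasure X × FiniteMeasure X =>
      (relaxedCost p α β t).toReal := by
  have hcont : Continuous fun z : X × X => dist z.1 z.2 ^ p :=
    continuous_dist.rpow_const fun _ => Or.inr hp.le
  have hint : Continuous fun γ : FiniteMeasure (X × X) =>
      ∫ z, dist z.1 z.2 ^ p ∂(γ : Measure (X × X)) :=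
    FiniteMeasure.continuous_integral_continuousMap (⟨_, hcont⟩ : C(X × X, ℝ))
  have heq (t : FiniteMeasure (X × X) × FiniteMeasure X × FiniteMeasure X) :
      (relaxedCost p α β t).toReal = ∫ z, dist z.1 z.2 ^ p ∂(t.1 : Measure (X × X)) +
        β * t.1.mass + α * (t.2.1.mass + t.2.2.mass) := by
    have h0 : 0 ≤ ∫ z, dist z.1 z.2 ^ p ∂(t.1 : Measure (X × X)) :=
      integral_nonneg fun z => by positivity
    rw [relaxedCost, transportCost_eq_ofReal_integral hp, ENNReal.toReal_add (by finiteness)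
      (by finiteness), ENNReal.toReal_add (by finiteness) (by finiteness), ENNReal.toReal_mul,
      ENNReal.toReal_mul, ENNReal.toReal_ofReal h0, ENNReal.toReal_ofReal hα,
      ENNReal.toReal_ofReal hβ, ENNReal.toReal_add (by finiteness) (by finiteness)]
    rfl
  simp only [heq]
  have hm {Z : Type _} [MeasurableSpace Z] [TopologicalSpace Z] [OpensMeasurableSpace Z] :
      Continuous fun m : FiniteMeasure Z => (m.mass : ℝ) :=
    NNReal.continuous_coe.comp FiniteMeasure.continuous_mass
  exact ((hint.comp continuous_fst).add ((hm.comp continuous_fst).const_mul β)).add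
    (((hm.comp continuous_snd.fst).add (hm.comp continuous_snd.snd)).const_mul α)

theorem continuous_netMeasure :
    @Continuous (FiniteMeasure (X × X) × FiniteMeasure X × FiniteMeasure X) (SignedMeasure X) _
      (weakStar X) netMeasure := by
  let _ := weakStar X
  have h₁ : Continuous fun t : FiniteMeasure (X × X) × FiniteMeasure X × FiniteMeasure X =>
      (t.1.map Prod.fst + t.2.1, t.1.map Prod.snd + t.2.2) :=
    (((FiniteMeasure.continuous_map continuous_fst).comp continuous_fst).add
      continuous_snd.fst).prodMk
    (((FiniteMeasure.continuous_map continuous_snd).comp continuous_fst).add continuous_snd.snd)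
  have h₂ := continuous_weakStar_toSignedMeasure_sub.comp h₁
  exact h₂

theorem exists_relaxedCost_lt (hp0 : 0 < p) (hp1 : p ≤ 1) (hβ : 0 < β)
    (t : FiniteMeasure (X × X) × FiniteMeasure X × FiniteMeasure X)
    (hsing : ¬ (t.1.map Prod.fst).toMeasure ⟂ₘ (t.1.map Prod.snd).toMeasure) :
    ∃ t', netMeasure t' = netMeasure t ∧ relaxedCost p α β t' < relaxedCost p α β t := by
  have htri (x y z : X) : ENNReal.ofReal (dist x z ^ p) ≤
      ENNReal.ofReal (dist x y ^ p) + ENNReal.ofReal (dist y z ^ p) := by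
    rw [← ENNReal.ofReal_add (by positivity) (by positivity)]
    refine ENNReal.ofReal_le_ofReal ?_
    exact (Real.rpow_le_rpow dist_nonneg (dist_triangle x y z) hp0.le).trans
      (Real.rpow_add_le_add_rpow dist_nonneg dist_nonneg hp0.le hp1)
  have hcm : Measurable fun z : X × X => ENNReal.ofReal (dist z.1 z.2 ^ p) := by fun_prop
  obtain ⟨γ', τ, hτ, hfst, hsnd, hcost⟩ :=
    exists_shortcut_plan (t.1 : Measure (X × X)) hcm htri hsing
  have hτfin : IsFiniteMeasure τ :=
    isFiniteMeasure_of_le (t.1.map Prod.fst).toMeasure (hfst.le.trans' (Measure.le_add_left le_rfl))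
  have hγfin : IsFiniteMeasure γ' := by
    have : IsFiniteMeasure (γ'.map Prod.fst) :=
      isFiniteMeasure_of_le (t.1.map Prod.fst).toMeasure (hfst.le.trans' (Measure.le_add_right le_rfl))
    exact Measure.isFiniteMeasure_of_map measurable_fst.aemeasurable
  let g : FiniteMeasure (X × X) := ⟨γ', hγfin⟩
  let T : FiniteMeasure X := ⟨τ, hτfin⟩
  have hfst' : g.map Prod.fst + T = t.1.map Prod.fst := Subtype.ext hfst
  have hsnd' : g.map Prod.snd + T = t.1.map Prod.snd := Subtype.ext hsnd
  have hmass : t.1.mass = g.mass + T.mass := by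
    rw [mass_eq_map_fst, mass_eq_map_fst g, ← hfst']
    simp [FiniteMeasure.mass]
  have hT : T ≠ 0 := fun h => hτ (congrArg FiniteMeasure.toMeasure h)
  have hTm : 0 < T.mass := pos_iff_ne_zero.2 (FiniteMeasure.mass_nonzero_iff _ |>.2 hT)
  refine ⟨(g, t.2), ?_, ?_⟩
  · rw [netMeasure_eq, netMeasure_eq]
    simp only [← hfst', ← hsnd', FiniteMeasure.toMeasure_add, Measure.toSignedMeasure_add]
    abel
  · have hlt : (g.mass : ℝ≥0∞) < t.1.mass := by
      rw [hmass]; exact_mod_cast lt_add_of_pos_right _ hTm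
    have hfin : transportCost p (g : Measure (X × X)) ≠ ⊤ := by
      rw [transportCost_eq_ofReal_integral hp0]; exact ENNReal.ofReal_ne_top
    refine ENNReal.add_lt_add_right (by finiteness) ?_
    refine ENNReal.add_lt_add_of_le_of_lt hfin hcost ?_
    exact ENNReal.mul_lt_mul_right (by simpa using hβ) (by simp) hlt

theorem exists_minimizer_relaxedCost (hp : 0 < p) (hα : 0 < α) (hβ : 0 < β)
    {G : SignedMeasure X → ℝ} (hG : @Continuous _ _ (weakStar X) _ G)
    (hbdd : BddBelow (range G)) :
    ∃ t₀, ∀ t, G (netMeasure t₀) + (relaxedCost p α β t₀).toReal ≤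
      G (netMeasure t) + (relaxedCost p α β t).toReal := by
  obtain ⟨b, hb⟩ := hbdd
  have hcont : Continuous fun t => G (netMeasure t) + (relaxedCost p α β t).toReal :=
    (@Continuous.comp _ _ _ _ (weakStar X) _ _ _ hG continuous_netMeasure).add
      (continuous_toReal_relaxedCost hp hα.le hβ.le)
  set J := fun t => G (netMeasure t) + (relaxedCost p α β t).toReal
  let R : NNReal := ((J 0 - b) / min α β).toNNReal
  have hmin : 0 < min α β := lt_min hα hβ
  have hR {m : NNReal} {a : ℝ} {t} (ha : min α β ≤ a) (hm : ¬ m ≤ R)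
      (h : ENNReal.ofReal a * m ≤ relaxedCost p α β t) : J 0 ≤ J t := by
    have h₁ : a * m ≤ (relaxedCost p α β t).toReal := by
      have := ENNReal.toReal_mono (relaxedCost_lt_top hp t).ne h
      rwa [ENNReal.toReal_mul, ENNReal.toReal_ofReal (hmin.le.trans ha)] at this
    have h₂ : (J 0 - b) / min α β ≤ m :=
      (Real.le_coe_toNNReal _).trans (NNReal.coe_le_coe.2 (not_le.1 hm).le)
    rw [div_le_iff₀ hmin] at h₂
    have h₃ : b ≤ G (netMeasure t) := hb (mem_range_self _)
    have h₄ : (m : ℝ) * min α β ≤ a * m := by rw [mul_comm]; gcongr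
    change J 0 ≤ G (netMeasure t) + (relaxedCost p α β t).toReal
    linarith
  refine hcont.exists_forall_le' (x₀ := 0) ?_
  refine Filter.mem_cocompact.2
    ⟨_, (isCompact_setOfPred_finiteMeasure_le_of_compactSpace (X × X) R).prod
      ((isCompact_setOfPred_finiteMeasure_le_of_compactSpace X R).prod
        (isCompact_setOfPred_finiteMeasure_le_of_compactSpace X R)), fun t ht => ?_⟩
  change J 0 ≤ J t
  by_contra hJ
  refine ht ⟨?_, ?_, ?_⟩ <;> by_contra hm
  · exact hJ (hR (min_le_right _ _) hm (le_add_right le_add_self))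
  · exact hJ (hR (min_le_left _ _) hm (le_add_left (by gcongr; exact le_self_add)))
  · exact hJ (hR (min_le_left _ _) hm (le_add_left (by gcongr; exact le_add_self)))

theorem exists_minimizer_add_KRnorm (hp0 : 0 < p) (hp1 : p ≤ 1) (hα : 0 < α) (hβ : 0 < β)
    {G : SignedMeasure X → ℝ} (hG : @Continuous _ _ (weakStar X) _ G)
    (hbdd : BddBelow (range G)) :
    ∃ μ₀, ∀ μ, G μ₀ + (KRnorm p α β μ₀).toReal ≤ G μ + (KRnorm p α β μ).toReal := by
  obtain ⟨t₀, ht₀⟩ := exists_minimizer_relaxedCost hp0 hα hβ hG hbdd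
  have hsing : (t₀.1.map Prod.fst).toMeasure ⟂ₘ (t₀.1.map Prod.snd).toMeasure := by
    by_contra hsing
    obtain ⟨t, hnet, hlt⟩ := exists_relaxedCost_lt (α := α) hp0 hp1 hβ t₀ hsing
    have := ht₀ t
    rw [hnet] at this
    linarith [ENNReal.toReal_strict_mono (relaxedCost_lt_top hp0 t₀).ne hlt]
  refine ⟨netMeasure t₀, fun μ => ?_⟩
  have h₁ : (KRnorm p α β (netMeasure t₀)).toReal ≤ (relaxedCost p α β t₀).toReal :=
    ENNReal.toReal_mono (relaxedCost_lt_top hp0 t₀).ne (KRnorm_netMeasure_le hβ.le t₀ hsing)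
  have h₂ : ENNReal.ofReal (G (netMeasure t₀) + (relaxedCost p α β t₀).toReal - G μ) ≤
      KRnorm p α β μ := by
    refine le_KRnorm hβ.le fun t ht => ?_
    rw [ENNReal.ofReal_le_iff_le_toReal (relaxedCost_lt_top hp0 t).ne]
    linarith [ht ▸ ht₀ t]
  rw [ENNReal.ofReal_le_iff_le_toReal (KRnorm_lt_top μ).ne] at h₂
  linarith

end Relaxation

/-- existence of a minimizer of `F(Kμ) + ‖μ‖_{KR}`. -/
theorem exists_minimizer_KR_problem {n : ℕ} (Ω : Set (EuclideanSpace ℝ (Fin n)))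
    (hΩc : IsCompact Ω) (hΩ : Convex ℝ Ω) (p α β : ℝ) (hp0 : 0 < p) (hp1 : p ≤ 1)
    (hα : 0 < α) (hβ : 0 < β) {Y : Type*} [NormedAddCommGroup Y]
    [InnerProductSpace ℝ Y] [CompleteSpace Y] (K : SignedMeasure ↥Ω →ₗ[ℝ] Y)
    (hK : @Continuous (SignedMeasure ↥Ω) Y (weakStar ↥Ω) _ ⇑K)
    (F : Y → ℝ) (hFconv : ConvexOn ℝ Set.univ F) (hFbdd : BddBelow (Set.range F))
    (hFdiff : Differentiable ℝ F) :
    ∃ μbar : SignedMeasure ↥Ω, ∀ μ : SignedMeasure ↥Ω,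
      F (K μbar) + (KRnorm p α β μbar).toReal ≤ F (K μ) + (KRnorm p α β μ).toReal := by
  have : CompactSpace Ω := isCompact_iff_compactSpace.1 hΩc
  refine exists_minimizer_add_KRnorm (G := F ∘ K) hp0 hp1 hα hβ ?_
    (hFbdd.mono (Set.range_comp_subset_range _ _))
  exact @Continuous.comp _ _ _ (weakStar Ω) _ _ _ _ hFdiff.continuous hK
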